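/- If two infinite bubble rays ℬ₁ = (F_k)_{k≥0} and ℬ₂ = (G_k)_{k≥0} of the basilica polynomial f land at the same point of ℂ, then one of them is contained in the other, i.e. {F_k : k ≥ 0} ⊆ {G_k : k ≥ 0} or {G_k : k ≥ 0} ⊆ {F_k : k ≥ 0}. -/

import Mathlib

open Filter Topology

/-- The basilica polynomial `f(z) = z² − 1`. -/
noncomputable def fBasilica : ℂ → ℂ := fun z => z ^ 2 - 1

/-- The basin of attraction of the superattracting 2-cycle `0 ↦ −1 ↦ 0`. -/
def basilicaBasin : Set ℂ :=
  {z | Tendsto (fun n => fBasilica^[2 * n] z) atTop (𝓝 0) ∨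
       Tendsto (fun n => fBasilica^[2 * n] z) atTop (𝓝 (-1))}

/-- A bubble is a connected component of the basin. -/
def IsBubble (F : Set ℂ) : Prop :=
  ∃ z ∈ basilicaBasin, F = connectedComponentIn basilicaBasin z

/-- The bubble containing `0`. -/
noncomputable def B0 : Set ℂ := connectedComponentIn basilicaBasin 0

/-- The generation of a bubble: the least `n ≥ 0` with `f^[n] '' F ⊆ B0`. -/
noncomputable def bubbleGen (F : Set ℂ) : ℕ := sInf {n : ℕ | fBasilica^[n] '' F ⊆ B0}

/-- A bubble ray: a sequence of bubbles whose consecutive closures meet in exactly one point,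
with strictly increasing generations. -/
def IsBubbleRay (F : ℕ → Set ℂ) : Prop :=
  (∀ k, IsBubble (F k)) ∧
  (∀ k, ∃ x : ℂ, closure (F k) ∩ closure (F (k + 1)) = {x}) ∧
  (∀ k, bubbleGen (F k) < bubbleGen (F (k + 1)))

/-- An infinite bubble ray lands at `x` if the bubbles are eventually contained in every
ball around `x`. -/
def RayLandsAt (F : ℕ → Set ℂ) (x : ℂ) : Prop :=
  ∀ ε > (0 : ℝ), ∃ K : ℕ, ∀ k ≥ K, F k ⊆ Metric.ball x ε

namespace Basil

open Pointwise

/-- `a = (√5 - 1)/2`; the fixed point is `-a`. -/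
noncomputable def a : ℝ := (Real.sqrt 5 - 1) / 2

lemma a_sq : a ^ 2 = 1 - a := by
  have h : Real.sqrt 5 ^ 2 = 5 := Real.sq_sqrt (by norm_num)
  unfold a; nlinarith

lemma a_lo : 0.618 < a := by
  have : (2.236 : ℝ) < Real.sqrt 5 := by
    rw [Real.lt_sqrt (by norm_num)]; norm_num
  unfold a; linarith

lemma a_hi : a < 0.6181 := by
  have : Real.sqrt 5 < 2.2362 := by
    rw [Real.sqrt_lt' (by norm_num)]; norm_num
  unfold a; linarith

/-- the fixed point -/
noncomputable def al : ℂ := ((-a : ℝ) : ℂ)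


lemma f_apply (z : ℂ) : fBasilica z = z ^ 2 - 1 := rfl

lemma f_re (z : ℂ) : (fBasilica z).re = z.re ^ 2 - z.im ^ 2 - 1 := by
  simp [f_apply, pow_two]

lemma f_im (z : ℂ) : (fBasilica z).im = 2 * z.re * z.im := by
  simp [f_apply, pow_two]; ring

lemma f_neg (z : ℂ) : fBasilica (-z) = fBasilica z := by simp [f_apply]

lemma f_eq {z w : ℂ} (h : fBasilica z = fBasilica w) : z = w ∨ z = -w := by
  simp only [f_apply, sub_left_inj] at h
  exact sq_eq_sq_iff_eq_or_eq_neg.mp h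

lemma al_re : al.re = -a := by simp [al]
lemma al_im : al.im = 0 := by simp [al]

lemma eq_al {z : ℂ} (h1 : z.re = -a) (h2 : z.im = 0) : z = al :=
  Complex.ext (by rw [h1, al_re]) (by rw [h2, al_im])

lemma f_al : fBasilica al = al := by
  apply eq_al
  · rw [f_re, al_re, al_im]; have := a_sq; nlinarith
  · rw [f_im, al_im]; ring

lemma f_iter_al (n : ℕ) : fBasilica^[n] al = al := Function.iterate_fixed f_al n

lemma f_cont : Continuous fBasilica := by
  unfold fBasilica; fun_prop

lemma f_zero : fBasilica 0 = -1 := by simp [f_apply]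
lemma f_neg_one : fBasilica (-1) = 0 := by simp [f_apply]

lemma ff_small {z : ℂ} (h : ‖z‖ < 1 / 4) : ‖fBasilica (fBasilica z)‖ ≤ (3 / 4) * ‖z‖ := by
  have e : fBasilica (fBasilica z) = z * (z * (z ^ 2 - 2)) := by simp only [f_apply]; ring
  rw [e, norm_mul, norm_mul]
  have h2 : ‖z ^ 2 - 2‖ ≤ 3 := by
    calc ‖z ^ 2 - 2‖ ≤ ‖z ^ 2‖ + ‖(2 : ℂ)‖ := norm_sub_le _ _
      _ ≤ 3 := by
        rw [norm_pow]; simp; nlinarith [norm_nonneg z]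
  have h3 : ‖z‖ * ‖z ^ 2 - 2‖ ≤ 3 / 4 := by
    nlinarith [norm_nonneg z, norm_nonneg (z ^ 2 - 2)]
  nlinarith [norm_nonneg z]

lemma iter_small {z : ℂ} (h : ‖z‖ < 1 / 4) (n : ℕ) :
    ‖fBasilica^[2 * n] z‖ ≤ (3 / 4) ^ n * ‖z‖ := by
  induction n with
  | zero => simp
  | succ n ih =>
    have e : fBasilica^[2 * (n + 1)] z = fBasilica (fBasilica (fBasilica^[2 * n] z)) := by
      rw [show 2 * (n + 1) = (2 * n + 1) + 1 by ring, Function.iterate_succ_apply',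
        Function.iterate_succ_apply']
    have hp : ((3 : ℝ) / 4) ^ n ≤ 1 := pow_le_one₀ (by norm_num) (by norm_num)
    have hs : ‖fBasilica^[2 * n] z‖ < 1 / 4 := by
      nlinarith [norm_nonneg z]
    rw [e, pow_succ]
    have := ff_small hs
    nlinarith

lemma tendsto_small {z : ℂ} (h : ‖z‖ < 1 / 4) :
    Tendsto (fun n => fBasilica^[2 * n] z) atTop (𝓝 0) := by
  apply squeeze_zero_norm (iter_small h)
  have := (tendsto_pow_atTop_nhds_zero_of_lt_one (r := (3 / 4 : ℝ)) (by norm_num)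
    (by norm_num)).mul_const ‖z‖
  simpa using this

lemma mem_B_iff (z : ℂ) : z ∈ basilicaBasin ↔ ∃ n, ‖fBasilica^[n] z‖ < 1 / 4 := by
  constructor
  · rintro (h | h)
    · have := h.norm.eventually_lt_const (show ‖(0 : ℂ)‖ < 1 / 4 by simp)
      obtain ⟨n, hn⟩ := this.exists
      exact ⟨_, hn⟩
    · have h2 := (f_cont.tendsto (-1)).comp h
      rw [f_neg_one] at h2
      have := h2.norm.eventually_lt_const (show ‖(0 : ℂ)‖ < 1 / 4 by simp)
      obtain ⟨n, hn⟩ := this.exists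
      refine ⟨2 * n + 1, ?_⟩
      rw [Function.iterate_succ_apply']; exact hn
  · rintro ⟨n, hn⟩
    have h := tendsto_small hn
    rcases Nat.even_or_odd' n with ⟨m, rfl | rfl⟩
    · left
      rw [← tendsto_add_atTop_iff_nat m]
      convert h using 2 with k
      rw [← Function.iterate_add_apply]; congr 2; ring
    · right
      have h2 := (f_cont.tendsto 0).comp h
      rw [f_zero] at h2
      rw [← tendsto_add_atTop_iff_nat (m + 1)]
      convert h2 using 2 with k
      simp only [Function.comp]
      rw [← Function.iterate_add_apply, ← Function.iterate_succ_apply' fBasilica]; congr 2; omega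

lemma B_open : IsOpen basilicaBasin := by
  have : basilicaBasin = ⋃ n : ℕ, {z | ‖fBasilica^[n] z‖ < 1 / 4} := by
    ext z; simp [mem_B_iff]
  rw [this]
  refine isOpen_iUnion fun n => ?_
  exact isOpen_lt (f_cont.iterate n).norm continuous_const

lemma f_mem_B (z : ℂ) : fBasilica z ∈ basilicaBasin ↔ z ∈ basilicaBasin := by
  rw [mem_B_iff, mem_B_iff]
  constructor
  · rintro ⟨n, hn⟩; exact ⟨n + 1, hn⟩
  · rintro ⟨n, hn⟩
    refine ⟨n + 1, ?_⟩
    have := ff_small hn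
    rw [← Function.iterate_succ_apply, Function.iterate_succ_apply', Function.iterate_succ_apply']
    linarith [norm_nonneg (fBasilica^[n] z)]

lemma zero_mem_B : (0 : ℂ) ∈ basilicaBasin := (mem_B_iff 0).2 ⟨0, by simp⟩

lemma neg_one_mem_B : (-1 : ℂ) ∈ basilicaBasin := by rw [← f_mem_B, f_neg_one]; exact zero_mem_B

lemma neg_mem_B (z : ℂ) : -z ∈ basilicaBasin ↔ z ∈ basilicaBasin := by rw [← f_mem_B, f_neg, f_mem_B]

lemma big_iter {z : ℂ} (h : 9 / 5 ≤ ‖z‖) (n : ℕ) : 9 / 5 ≤ ‖fBasilica^[n] z‖ := by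
  induction n with
  | zero => simpa
  | succ n ih =>
    rw [Function.iterate_succ_apply', f_apply]
    have := norm_sub_norm_le ((fBasilica^[n] z) ^ 2) 1
    rw [norm_pow, norm_one] at this
    nlinarith

lemma B_norm {z : ℂ} (h : z ∈ basilicaBasin) : ‖z‖ ≤ 9 / 5 := by
  by_contra hc
  obtain ⟨n, hn⟩ := (mem_B_iff z).1 h
  have := big_iter (not_le.1 hc).le n
  linarith

/-- The closure of the basin. -/
def X : Set ℂ := closure basilicaBasin

lemma X_norm {z : ℂ} (h : z ∈ X) : ‖z‖ ≤ 9 / 5 := by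
  have : closure basilicaBasin ⊆ {z | ‖z‖ ≤ 9 / 5} :=
    closure_minimal (fun z hz => B_norm hz) (isClosed_le continuous_norm continuous_const)
  exact this h

lemma f_mem_X {z : ℂ} (h : z ∈ X) : fBasilica z ∈ X :=
  map_mem_closure f_cont h (fun w hw => (f_mem_B w).2 hw)

lemma neg_mem_X {z : ℂ} (h : z ∈ X) : -z ∈ X :=
  map_mem_closure continuous_neg h (fun w hw => (neg_mem_B w).2 hw)

lemma iter_mem_X {z : ℂ} (h : z ∈ X) (n : ℕ) : fBasilica^[n] z ∈ X := by
  induction n with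
  | zero => exact h
  | succ n ih => rw [Function.iterate_succ_apply']; exact f_mem_X ih

lemma X_im {z : ℂ} (h : z ∈ X) : z.im ^ 2 < 1 := by
  by_contra hc
  have h1 := X_norm (f_mem_X h)
  have h2 : ‖fBasilica z‖ ^ 2 = (fBasilica z).re ^ 2 + (fBasilica z).im ^ 2 := by
    rw [Complex.sq_norm, Complex.normSq_apply]; ring
  rw [f_re, f_im] at h2
  have h3 : ‖fBasilica z‖ ^ 2 ≤ (9 / 5) ^ 2 := by
    apply pow_le_pow_left₀ (norm_nonneg _) h1
  push Not at hc
  nlinarith [sq_nonneg (z.re ^ 2), mul_nonneg (sub_nonneg.2 hc) (sq_nonneg z.re),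
    sq_nonneg z.re]

/-- one step in the escaping region -/
lemma S_step {z : ℂ} (hX : z ∈ X) (h1 : z.re ≤ -a)
    (h2 : -a - z.im ^ 2 / (4 * a ^ 2) ≤ z.re) :
    (fBasilica z).re ≤ -a ∧ -a - (fBasilica z).im ^ 2 / (4 * a ^ 2) ≤ (fBasilica z).re ∧
      (3 / 2) * z.im ^ 2 ≤ (fBasilica z).im ^ 2 := by
  have ha := a_lo
  have hb := a_hi
  have hs := a_sq
  have hpos : 0 < 4 * a ^ 2 := by positivity
  have hi := X_im (f_mem_X hX)
  rw [f_im] at hi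
  obtain ⟨s, hs'⟩ : ∃ s, z.re = -a - s := ⟨-a - z.re, by ring⟩
  have s0 : 0 ≤ s := by linarith
  rw [f_re, f_im]
  set v := z.im with hv
  rw [hs'] at hi h2 ⊢
  have h3 : s * (4 * a ^ 2) ≤ v ^ 2 := by
    rw [← le_div_iff₀ hpos]; linarith
  refine ⟨?_, ?_, ?_⟩
  · by_contra hc
    push Not at hc
    have hc' : v ^ 2 < 2 * a * s + s ^ 2 := by nlinarith
    have e : (2 * (-a - s) * v) ^ 2 = 4 * v ^ 2 * (a ^ 2 + 2 * a * s + s ^ 2) := by ring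
    rw [e] at hi
    have h5 : s * 1.527 ≤ v ^ 2 := by nlinarith
    have h6 : s * 1.527 < 2 * 0.6181 * s + s ^ 2 := by nlinarith
    have h7 : 0.29 < s := by nlinarith
    have h8 : 0.44 < v ^ 2 := by nlinarith
    nlinarith
  · have : (2 * (-a - s) * v) ^ 2 / (4 * a ^ 2) = (a + s) ^ 2 * v ^ 2 / a ^ 2 := by
      field_simp; ring
    rw [this]
    have h9 : v ^ 2 ≤ (a + s) ^ 2 * v ^ 2 / a ^ 2 := by
      rw [le_div_iff₀ (by positivity)]
      have : a ^ 2 ≤ (a + s) ^ 2 := by nlinarith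
      nlinarith [sq_nonneg v]
    nlinarith
  · have e : (2 * (-a - s) * v) ^ 2 = 4 * v ^ 2 * (a + s) ^ 2 := by ring
    have : a ^ 2 ≤ (a + s) ^ 2 := by nlinarith
    rw [e]; nlinarith [sq_nonneg v]

lemma S_al {z : ℂ} (hX : z ∈ X) (h1 : z.re ≤ -a)
    (h2 : -a - z.im ^ 2 / (4 * a ^ 2) ≤ z.re) : z = al := by
  have key : ∀ n : ℕ, (fBasilica^[n] z).re ≤ -a ∧
      -a - (fBasilica^[n] z).im ^ 2 / (4 * a ^ 2) ≤ (fBasilica^[n] z).re ∧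
      (3 / 2) ^ n * z.im ^ 2 ≤ (fBasilica^[n] z).im ^ 2 := by
    intro n
    induction n with
    | zero => exact ⟨h1, h2, by simp⟩
    | succ n ih =>
      obtain ⟨i1, i2, i3⟩ := ih
      obtain ⟨j1, j2, j3⟩ := S_step (iter_mem_X hX n) i1 i2
      rw [Function.iterate_succ_apply']
      refine ⟨j1, j2, ?_⟩
      rw [pow_succ]; nlinarith
  have hv : z.im = 0 := by
    by_contra hne
    have hp : 0 < z.im ^ 2 := by positivity
    obtain ⟨n, hn⟩ := pow_unbounded_of_one_lt (1 / z.im ^ 2) (show (1 : ℝ) < 3 / 2 by norm_num)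
    rw [div_lt_iff₀ hp] at hn
    have := (key n).2.2
    have := X_im (iter_mem_X hX n)
    linarith
  refine eq_al ?_ hv
  rw [hv] at h2
  simp at h2
  linarith

lemma line_al {z : ℂ} (hX : z ∈ X) (h1 : z.re = -a) : z = al := by
  refine S_al hX h1.le ?_
  rw [h1]
  have : 0 ≤ z.im ^ 2 / (4 * a ^ 2) := by positivity
  linarith

lemma line_neg_al {z : ℂ} (hX : z ∈ X) (h1 : z.re = a) : z = -al := by
  rw [← line_al (neg_mem_X hX) (by simp [h1]), neg_neg]

lemma f_strip {z : ℂ} (h : |z.re| < a) : (fBasilica z).re < -a := by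
  rw [f_re]
  have := a_sq
  have h2 : z.re ^ 2 < a ^ 2 := sq_lt_sq' (by linarith [(abs_lt.1 h).1]) (abs_lt.1 h).2
  nlinarith [sq_nonneg z.im]

lemma f_out {z : ℂ} (hX : z ∈ X) (h : z.re < -a) : -a < (fBasilica z).re := by
  by_contra hc
  push Not at hc
  have ha := a_lo
  have hs := a_sq
  have h2 : a ^ 2 < z.re ^ 2 := by nlinarith
  have : fBasilica z = al := by
    refine S_al (f_mem_X hX) hc ?_
    have : (fBasilica z).im ^ 2 / (4 * a ^ 2) = z.re ^ 2 * z.im ^ 2 / a ^ 2 := by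
      rw [f_im]; field_simp; ring
    rw [this, f_re]
    have h9 : z.im ^ 2 ≤ z.re ^ 2 * z.im ^ 2 / a ^ 2 := by
      rw [le_div_iff₀ (by positivity)]
      nlinarith [sq_nonneg z.im]
    nlinarith
  rw [← f_al] at this
  rcases f_eq this with h3 | h3
  · rw [h3, al_re] at h; linarith
  · rw [h3, Complex.neg_re, al_re] at h; linarith

/-- real dynamics -/
lemma seg_B {t : ℝ} (h : |t| < a) : (t : ℂ) ∈ basilicaBasin := by
  have ha := a_lo
  have hb := a_hi
  have hs := a_sq
  have hff : ∀ u : ℝ, fBasilica (fBasilica (u : ℂ)) = ((u ^ 2 * (u ^ 2 - 2) : ℝ) : ℂ) := by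
    intro u; simp only [f_apply]; push_cast; ring
  set q := |t| * (2 - |t| ^ 2) with hq
  have hq0 : 0 ≤ q := by
    have := abs_nonneg t
    have : |t| ^ 2 ≤ 2 := by nlinarith
    exact mul_nonneg (abs_nonneg t) (by linarith)
  have hq1 : q < 1 := by
    have h0 := abs_nonneg t
    have : 1 - q = (1 - |t|) * (1 - |t| - |t| ^ 2) := by rw [hq]; ring
    have h3 : 0 < 1 - |t| - |t| ^ 2 := by nlinarith
    have h4 : 0 < 1 - |t| := by linarith
    nlinarith [mul_pos h4 h3]
  have key : ∀ n : ℕ, ∃ u : ℝ, fBasilica^[2 * n] (t : ℂ) = u ∧ |u| ≤ q ^ n * |t| := by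
    intro n
    induction n with
    | zero => exact ⟨t, by simp⟩
    | succ n ih =>
      obtain ⟨u, hu, hle⟩ := ih
      refine ⟨u ^ 2 * (u ^ 2 - 2), ?_, ?_⟩
      · rw [show 2 * (n + 1) = (2 * n + 1) + 1 by ring, Function.iterate_succ_apply',
          Function.iterate_succ_apply', hu, hff]
      · have hp : q ^ n ≤ 1 := pow_le_one₀ hq0 hq1.le
        have ht0 := abs_nonneg t
        have hu0 := abs_nonneg u
        have hut : |u| ≤ |t| := by nlinarith
        have e : |u ^ 2 * (u ^ 2 - 2)| = |u| * (|u| * (2 - |u| ^ 2)) := by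
          rw [abs_mul, abs_of_nonneg (sq_nonneg u), abs_of_nonpos, ← sq_abs u]
          · ring
          · rw [← sq_abs u]; nlinarith
        have h5 : |u| * (2 - |u| ^ 2) ≤ q := by
          have : q - |u| * (2 - |u| ^ 2) = (|t| - |u|) * (2 - |t| ^ 2 - |t| * |u| - |u| ^ 2) := by
            rw [hq]; ring
          have h6 : 0 ≤ 2 - |t| ^ 2 - |t| * |u| - |u| ^ 2 := by nlinarith
          nlinarith [mul_nonneg (sub_nonneg.2 hut) h6]
        rw [e, pow_succ]
        have : 0 ≤ |u| * (2 - |u| ^ 2) := mul_nonneg hu0 (by nlinarith)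
        calc |u| * (|u| * (2 - |u| ^ 2)) ≤ (q ^ n * |t|) * q := by
              apply mul_le_mul hle h5 this; positivity
          _ = q ^ n * q * |t| := by ring
  rw [mem_B_iff]
  obtain ⟨n, hn⟩ := exists_pow_lt_of_lt_one (show (0 : ℝ) < 1 / 4 by norm_num) hq1
  obtain ⟨u, hu, hle⟩ := key n
  refine ⟨2 * n, ?_⟩
  rw [hu, Complex.norm_real, Real.norm_eq_abs]
  have : 0 ≤ q ^ n := by positivity
  have : |t| ≤ 1 := by linarith
  nlinarith

lemma al_not_B : al ∉ basilicaBasin := by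
  rw [mem_B_iff]
  rintro ⟨n, hn⟩
  rw [f_iter_al, al, Complex.norm_real, Real.norm_eq_abs, abs_neg] at hn
  have := a_lo
  rw [abs_of_pos (by linarith)] at hn
  linarith

/-! ### Bubbles -/

lemma bub_open {F : Set ℂ} (h : IsBubble F) : IsOpen F := by
  obtain ⟨z, -, rfl⟩ := h; exact B_open.connectedComponentIn

lemma bub_conn {F : Set ℂ} (h : IsBubble F) : IsPreconnected F := by
  obtain ⟨z, -, rfl⟩ := h; exact isPreconnected_connectedComponentIn

lemma bub_ne {F : Set ℂ} (h : IsBubble F) : F.Nonempty := by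
  obtain ⟨z, hz, rfl⟩ := h; exact ⟨z, mem_connectedComponentIn hz⟩

lemma bub_sub {F : Set ℂ} (h : IsBubble F) : F ⊆ basilicaBasin := by
  obtain ⟨z, hz, rfl⟩ := h; exact connectedComponentIn_subset _ _

lemma bub_cl_X {F : Set ℂ} (h : IsBubble F) {x : ℂ} (hx : x ∈ closure F) : x ∈ X :=
  closure_mono (bub_sub h) hx

lemma bub_max {F C : Set ℂ} (h : IsBubble F) (hC : IsPreconnected C) (hCB : C ⊆ basilicaBasin) {z : ℂ}
    (h1 : z ∈ C) (h2 : z ∈ F) : C ⊆ F := by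
  obtain ⟨w, hw, rfl⟩ := h
  rw [connectedComponentIn_eq h2]
  exact hC.subset_connectedComponentIn h1 hCB

lemma bub_eq {F G : Set ℂ} (hF : IsBubble F) (hG : IsBubble G) {z : ℂ}
    (h1 : z ∈ F) (h2 : z ∈ G) : F = G :=
  Set.Subset.antisymm (bub_max hG (bub_conn hF) (bub_sub hF) h1 h2)
    (bub_max hF (bub_conn hG) (bub_sub hG) h2 h1)

lemma bub_cl_eq {F G : Set ℂ} (hF : IsBubble F) (hG : IsBubble G) {z : ℂ}
    (h1 : z ∈ closure F) (h2 : z ∈ G) : F = G := by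
  obtain ⟨w, hw1, hw2⟩ := mem_closure_iff.1 h1 G (bub_open hG) h2
  exact bub_eq hF hG hw2 hw1

lemma bub_cl {F : Set ℂ} (hF : IsBubble F) {z : ℂ}
    (h1 : z ∈ closure F) (h2 : z ∈ basilicaBasin) : z ∈ F := by
  have hG : IsBubble (connectedComponentIn basilicaBasin z) := ⟨z, h2, rfl⟩
  rw [bub_cl_eq hF hG h1 (mem_connectedComponentIn h2)]
  exact mem_connectedComponentIn h2

lemma bub_cpt {F : Set ℂ} (hF : IsBubble F) : IsCompact (closure F) := by
  apply Metric.isCompact_of_isClosed_isBounded isClosed_closure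
  refine (Metric.isBounded_closedBall (x := (0 : ℂ)) (r := 9 / 5)).subset ?_
  intro z hz
  rw [mem_closedBall_zero_iff]
  exact X_norm (bub_cl_X hF hz)

lemma cl_image {F : Set ℂ} (hF : IsBubble F) : closure (fBasilica '' F) = fBasilica '' closure F :=
  (image_closure_of_isCompact (bub_cpt hF) f_cont.continuousOn).symm

lemma f_open {U : Set ℂ} (hU : IsOpen U) : IsOpen (fBasilica '' U) := by
  have han : AnalyticOnNhd ℂ fBasilica Set.univ := by
    have hd : Differentiable ℂ fBasilica := by unfold fBasilica; fun_prop
    exact fun z _ => hd.analyticAt z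
  rcases han.is_constant_or_isOpen isPreconnected_univ with ⟨w, hw⟩ | h
  · have h1 := hw 0 trivial
    have h2 := hw (-1) trivial
    rw [f_zero] at h1; rw [f_neg_one] at h2
    rw [← h2] at h1; norm_num at h1
  · exact h U (Set.subset_univ _) hU

lemma bub_image {F : Set ℂ} (hF : IsBubble F) : IsBubble (fBasilica '' F) := by
  obtain ⟨z, hz⟩ := bub_ne hF
  have hfz : fBasilica z ∈ basilicaBasin := (f_mem_B z).2 (bub_sub hF hz)
  refine ⟨fBasilica z, hfz, ?_⟩
  have hsub : fBasilica '' F ⊆ basilicaBasin := by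
    rintro _ ⟨w, hw, rfl⟩; exact (f_mem_B w).2 (bub_sub hF hw)
  apply Set.Subset.antisymm
  · exact ((bub_conn hF).image fBasilica f_cont.continuousOn).subset_connectedComponentIn
      ⟨z, hz, rfl⟩ hsub
  · apply isPreconnected_connectedComponentIn.subset_of_closure_inter_subset
      (f_open (bub_open hF))
    · exact ⟨fBasilica z, mem_connectedComponentIn hfz, ⟨z, hz, rfl⟩⟩
    · rintro y ⟨hy1, hy2⟩
      rw [cl_image hF] at hy1
      obtain ⟨w, hw, rfl⟩ := hy1
      exact ⟨w, bub_cl hF hw ((f_mem_B w).1 (connectedComponentIn_subset _ _ hy2)), rfl⟩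

lemma it_succ (n : ℕ) (F : Set ℂ) : fBasilica^[n + 1] '' F = fBasilica^[n] '' (fBasilica '' F) := by
  rw [Function.iterate_succ, Set.image_comp]

lemma it_succ' (n : ℕ) (F : Set ℂ) : fBasilica^[n + 1] '' F = fBasilica '' (fBasilica^[n] '' F) := by
  rw [Function.iterate_succ', Set.image_comp]

lemma it_add (m n : ℕ) (F : Set ℂ) : fBasilica^[m + n] '' F = fBasilica^[m] '' (fBasilica^[n] '' F) := by
  rw [Function.iterate_add, Set.image_comp]

lemma it_zero (F : Set ℂ) : fBasilica^[0] '' F = F := by simp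

lemma bub_it {F : Set ℂ} (hF : IsBubble F) (n : ℕ) : IsBubble (fBasilica^[n] '' F) := by
  induction n with
  | zero => rwa [it_zero]
  | succ n ih => rw [it_succ']; exact bub_image ih

lemma it_cl {F : Set ℂ} (n : ℕ) {x : ℂ} (hx : x ∈ closure F) :
    fBasilica^[n] x ∈ closure (fBasilica^[n] '' F) :=
  map_mem_closure (f_cont.iterate n) hx (fun z hz => ⟨z, hz, rfl⟩)

lemma bub_neg {F : Set ℂ} (hF : IsBubble F) : IsBubble (-F) := by
  have key : ∀ z, z ∈ basilicaBasin → -(connectedComponentIn basilicaBasin z) ⊆ connectedComponentIn basilicaBasin (-z) := by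
    intro z hz
    rw [← Set.image_neg_eq_neg]
    apply (isPreconnected_connectedComponentIn.image _
      continuous_neg.continuousOn).subset_connectedComponentIn
    · exact ⟨z, mem_connectedComponentIn hz, rfl⟩
    · rintro _ ⟨w, hw, rfl⟩
      exact (neg_mem_B w).2 (connectedComponentIn_subset _ _ hw)
  obtain ⟨z, hz, rfl⟩ := hF
  refine ⟨-z, (neg_mem_B z).2 hz, Set.Subset.antisymm (key z hz) ?_⟩
  have := key (-z) ((neg_mem_B z).2 hz)
  rw [neg_neg] at this
  intro w hw
  exact this (by simpa using hw)

lemma cl_neg {F : Set ℂ} {x : ℂ} (hx : x ∈ closure F) : -x ∈ closure (-F) :=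
  map_mem_closure continuous_neg hx (fun z hz => by simpa using hz)

lemma merge {F G : Set ℂ} (hF : IsBubble F) (hG : IsBubble G) (h : fBasilica '' F = fBasilica '' G) :
    F = G ∨ F = -G := by
  obtain ⟨z, hz⟩ := bub_ne hF
  have : fBasilica z ∈ fBasilica '' G := h ▸ ⟨z, hz, rfl⟩
  obtain ⟨w, hw, hwz⟩ := this
  rcases f_eq hwz with rfl | rfl
  · exact Or.inl (bub_eq hF hG hz hw)
  · exact Or.inr (bub_eq hF (bub_neg hG) hz (by simpa using hw))

lemma B0_bub : IsBubble B0 := ⟨0, zero_mem_B, rfl⟩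
lemma zero_mem_B0 : (0 : ℂ) ∈ B0 := mem_connectedComponentIn zero_mem_B
lemma neg_B0 : -B0 = B0 := bub_eq (bub_neg B0_bub) B0_bub (z := 0)
  (by simpa using zero_mem_B0) zero_mem_B0

lemma neg_al_not_B : -al ∉ basilicaBasin := fun h => al_not_B ((neg_mem_B _).1 h)

lemma seg_B0 {z : ℂ} (h1 : |z.re| < a) (h2 : z.im = 0) : z ∈ B0 := by
  have hpc : IsPreconnected ((fun t : ℝ => (t : ℂ)) '' Set.Ioo (-a) a) :=
    isPreconnected_Ioo.image _ Complex.continuous_ofReal.continuousOn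
  have ha := a_lo
  have : (fun t : ℝ => (t : ℂ)) '' Set.Ioo (-a) a ⊆ B0 := by
    refine bub_max B0_bub hpc ?_ (z := 0) ⟨0, ⟨by linarith, by linarith⟩, by simp⟩ zero_mem_B0
    rintro _ ⟨t, ht, rfl⟩
    exact seg_B (abs_lt.2 ht)
  exact this ⟨z.re, abs_lt.1 h1, Complex.ext (by simp) (by simp [h2])⟩

lemma B0_strip {z : ℂ} (h : z ∈ B0) : |z.re| < a := by
  have ho1 : IsOpen {z : ℂ | |z.re| < a} :=
    isOpen_lt Complex.continuous_re.abs continuous_const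
  have ho2 : IsOpen {z : ℂ | a < |z.re|} :=
    isOpen_lt continuous_const Complex.continuous_re.abs
  have ha := a_lo
  have : B0 ⊆ {z : ℂ | |z.re| < a} := by
    refine IsPreconnected.subset_left_of_subset_union ho1 ho2 ?_ ?_ ?_ (bub_conn B0_bub)
    · rw [Set.disjoint_left]; intro z h1 h2
      simp only [Set.mem_ofPred_eq] at h1 h2; linarith
    · intro z hz
      rcases lt_trichotomy |z.re| a with h | h | h
      · exact Or.inl h
      · exfalso
        have hX : z ∈ X := subset_closure (bub_sub B0_bub hz)
        rcases (abs_eq (by linarith)).1 h with h | h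
        · exact neg_al_not_B (line_neg_al hX h ▸ bub_sub B0_bub hz)
        · exact al_not_B (line_al hX h ▸ bub_sub B0_bub hz)
      · exact Or.inr h
    · exact ⟨0, zero_mem_B0, by simp; linarith⟩
  exact this h

/-- the bubble of `-1` -/
def Bm : Set ℂ := fBasilica '' B0

lemma Bm_bub : IsBubble Bm := bub_image B0_bub

lemma Bm_left {z : ℂ} (h : z ∈ Bm) : z.re < -a := by
  obtain ⟨w, hw, rfl⟩ := h; exact f_strip (B0_strip hw)

lemma f_Bm : fBasilica '' Bm = B0 := by
  refine bub_eq (bub_image Bm_bub) B0_bub (z := 0) ?_ zero_mem_B0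
  exact ⟨-1, ⟨0, zero_mem_B0, f_zero⟩, f_neg_one⟩

lemma Bm_ne : Bm ≠ B0 := by
  intro h
  have h1 := Bm_left (h ▸ zero_mem_B0)
  have := a_lo
  simp at h1; linarith

lemma pre_Bm {F : Set ℂ} (hF : IsBubble F) (h : fBasilica '' F = Bm) : F = B0 := by
  rcases merge hF B0_bub h with h | h
  · exact h
  · rw [h, neg_B0]

lemma pre_B0 {F : Set ℂ} (hF : IsBubble F) (h : fBasilica '' F = B0) : F = Bm ∨ F = -Bm :=
  merge hF Bm_bub (h.trans f_Bm.symm)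

lemma it_B0_even (n : ℕ) : fBasilica^[2 * n] '' B0 = B0 := by
  induction n with
  | zero => simp
  | succ n ih =>
    rw [show 2 * (n + 1) = (2 * n + 1) + 1 by ring, it_succ, it_succ]
    change fBasilica^[2 * n] '' (fBasilica '' Bm) = B0
    rw [f_Bm, ih]

lemma it_B0_odd (n : ℕ) : fBasilica^[2 * n + 1] '' B0 = Bm := by
  rw [it_succ', it_B0_even]; rfl

lemma cl_re_le {F : Set ℂ} {c : ℝ} (h : ∀ z ∈ F, z.re ≤ c) {x : ℂ} (hx : x ∈ closure F) :
    x.re ≤ c :=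
  closure_minimal (t := {z : ℂ | z.re ≤ c}) h
    (isClosed_le Complex.continuous_re continuous_const) hx

lemma cl_le_re {F : Set ℂ} {c : ℝ} (h : ∀ z ∈ F, c ≤ z.re) {x : ℂ} (hx : x ∈ closure F) :
    c ≤ x.re :=
  closure_minimal (t := {z : ℂ | c ≤ z.re}) h
    (isClosed_le continuous_const Complex.continuous_re) hx

lemma exists_it {F : Set ℂ} (hF : IsBubble F) : ∃ n, fBasilica^[n] '' F = B0 := by
  obtain ⟨z, hz⟩ := bub_ne hF
  have hball : Metric.ball (0 : ℂ) (1 / 4) ⊆ B0 := by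
    refine bub_max B0_bub (convex_ball _ _).isPreconnected ?_ (z := 0) (by simp) zero_mem_B0
    intro w hw
    exact (mem_B_iff w).2 ⟨0, by simpa using hw⟩
  obtain ⟨n, hn⟩ := (mem_B_iff z).1 (bub_sub hF hz)
  exact ⟨n, bub_eq (bub_it hF n) B0_bub ⟨z, hz, rfl⟩ (hball (mem_ball_zero_iff.2 hn))⟩

lemma it_sub_iff {F : Set ℂ} (hF : IsBubble F) (n : ℕ) :
    fBasilica^[n] '' F ⊆ B0 ↔ fBasilica^[n] '' F = B0 := by
  constructor
  · intro h
    obtain ⟨z, hz⟩ := bub_ne (bub_it hF n)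
    exact bub_eq (bub_it hF n) B0_bub hz (h hz)
  · intro h; rw [h]

lemma gen_spec {F : Set ℂ} (hF : IsBubble F) : fBasilica^[bubbleGen F] '' F = B0 := by
  obtain ⟨n, hn⟩ := exists_it hF
  rw [← it_sub_iff hF]
  exact Nat.sInf_mem (s := {n : ℕ | fBasilica^[n] '' F ⊆ B0}) ⟨n, hn.subset⟩

lemma gen_le {F : Set ℂ} {n : ℕ} (h : fBasilica^[n] '' F = B0) : bubbleGen F ≤ n :=
  Nat.sInf_le (s := {n : ℕ | fBasilica^[n] '' F ⊆ B0}) h.subset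

lemma gen_pos {F : Set ℂ} (hF : IsBubble F) : 1 ≤ bubbleGen F ↔ F ≠ B0 := by
  constructor
  · rintro h rfl
    have : bubbleGen B0 ≤ 0 := gen_le (it_zero _)
    omega
  · intro h
    by_contra hc
    have h0 : bubbleGen F = 0 := by omega
    have := gen_spec hF
    rw [h0, it_zero] at this
    exact h this

lemma gen_image {F : Set ℂ} (hF : IsBubble F) (h : 1 ≤ bubbleGen F) :
    bubbleGen (fBasilica '' F) = bubbleGen F - 1 := by
  have h1 := gen_spec hF
  obtain ⟨m, hm⟩ : ∃ m, bubbleGen F = m + 1 := ⟨bubbleGen F - 1, by omega⟩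
  rw [hm, it_succ] at h1
  have h2 := gen_le h1
  have h3 := gen_spec (bub_image hF)
  rw [← it_succ] at h3
  have h4 := gen_le h3
  omega

lemma it_ne_B0 {F : Set ℂ} {n : ℕ} (h : n < bubbleGen F) : fBasilica^[n] '' F ≠ B0 :=
  fun h' => by have := gen_le h'; omega

/-- Bubbles whose closure contains the fixed point. -/
lemma al_cl {F : Set ℂ} (hF : IsBubble F) (h : al ∈ closure F) : F = B0 ∨ F = Bm := by
  obtain ⟨n, hn⟩ := exists_it hF
  induction n generalizing F with
  | zero => left; rwa [it_zero] at hn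
  | succ n ih =>
    rw [it_succ] at hn
    have h1 : al ∈ closure (fBasilica '' F) := by
      rw [cl_image hF]; exact ⟨al, h, f_al⟩
    rcases ih (bub_image hF) h1 hn with h2 | h2
    · rcases pre_B0 hF h2 with h3 | h3
      · exact Or.inr h3
      · exfalso
        have ha := a_lo
        have : a ≤ al.re := by
          refine cl_le_re (fun z hz => ?_) h
          rw [h3] at hz
          have := Bm_left (z := -z) (by simpa using hz)
          simp at this; linarith
        rw [al_re] at this; linarith
    · exact Or.inl (pre_Bm hF h2)

/-- The four pieces. -/
inductive Pc | l | r | u | d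

def Q : Pc → Set ℂ
  | .l => {z | z.re < -a}
  | .r => {z | a < z.re}
  | .u => {z | |z.re| < a ∧ 0 < z.im}
  | .d => {z | |z.re| < a ∧ z.im < 0}

lemma Q_open (i : Pc) : IsOpen (Q i) := by
  cases i
  · exact isOpen_lt Complex.continuous_re continuous_const
  · exact isOpen_lt continuous_const Complex.continuous_re
  · exact (isOpen_lt Complex.continuous_re.abs continuous_const).inter
      (isOpen_lt continuous_const Complex.continuous_im)
  · exact (isOpen_lt Complex.continuous_re.abs continuous_const).inter
      (isOpen_lt Complex.continuous_im continuous_const)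

lemma Q_disj {i j : Pc} {z : ℂ} (h1 : z ∈ Q i) (h2 : z ∈ Q j) : i = j := by
  have ha := a_lo
  cases i <;> cases j <;> first | rfl | skip
  all_goals
    exfalso
    simp only [Q, Set.mem_ofPred_eq, abs_lt] at h1 h2
    linarith

lemma Q_neg {i : Pc} {z : ℂ} (h1 : z ∈ Q i) (h2 : -z ∈ Q i) : False := by
  have ha := a_lo
  cases i <;> simp only [Q, Set.mem_ofPred_eq, Complex.neg_re, Complex.neg_im] at h1 h2
  · linarith
  · linarith
  · linarith [h1.2, h2.2]
  · linarith [h1.2, h2.2]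

lemma mem_Q {z : ℂ} (hX : z ∈ X) (h0 : z ∉ B0) (h1 : z ≠ al) (h2 : z ≠ -al) :
    ∃ i, z ∈ Q i := by
  have ha := a_lo
  rcases lt_trichotomy z.re (-a) with h | h | h
  · exact ⟨.l, h⟩
  · exact absurd (line_al hX h) h1
  rcases lt_trichotomy z.re a with h' | h' | h'
  · have hh : |z.re| < a := abs_lt.2 ⟨h, h'⟩
    rcases lt_trichotomy z.im 0 with g | g | g
    · exact ⟨.d, hh, g⟩
    · exact absurd (seg_B0 hh g) h0
    · exact ⟨.u, hh, g⟩
  · exact absurd (line_neg_al hX h') h2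
  · exact ⟨.r, h'⟩

lemma bub_Q {F : Set ℂ} (hF : IsBubble F) (h : F ≠ B0) : ∃ i, F ⊆ Q i := by
  have hall : ∀ z ∈ F, ∃ i, z ∈ Q i := by
    intro z hz
    refine mem_Q (subset_closure (bub_sub hF hz)) (fun h' => h (bub_eq hF B0_bub hz h')) ?_ ?_
    · rintro rfl; exact al_not_B (bub_sub hF hz)
    · rintro rfl; exact neg_al_not_B (bub_sub hF hz)
  obtain ⟨z, hz⟩ := bub_ne hF
  obtain ⟨i, hi⟩ := hall z hz
  refine ⟨i, IsPreconnected.subset_left_of_subset_union (Q_open i)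
    (v := ⋃ j, ⋃ (_ : j ≠ i), Q j) (isOpen_iUnion fun j => isOpen_iUnion fun _ => Q_open j)
    ?_ ?_ ⟨z, hz, hi⟩ (bub_conn hF)⟩
  · rw [Set.disjoint_left]
    intro w h1 h2
    simp only [Set.mem_iUnion] at h2
    obtain ⟨j, hj, hw⟩ := h2
    exact hj (Q_disj hw h1)
  · intro w hw
    obtain ⟨j, hj⟩ := hall w hw
    by_cases hji : j = i
    · left; rwa [← hji]
    · right; simp only [Set.mem_iUnion]; exact ⟨j, hji, hj⟩

lemma cl_Q {F : Set ℂ} (hF : IsBubble F) (h : F ≠ B0) {i : Pc} (hi : F ⊆ Q i) {x : ℂ}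
    (hx : x ∈ closure F) (h1 : x ≠ al) (h2 : x ≠ -al) : x ∈ Q i := by
  obtain ⟨j, hj⟩ := mem_Q (bub_cl_X hF hx) (fun h' => h (bub_cl_eq hF B0_bub hx h')) h1 h2
  obtain ⟨w, hw1, hw2⟩ := mem_closure_iff.1 hx _ (Q_open j) hj
  rwa [Q_disj (hi hw2) hw1]

lemma Bm_Q : Bm ⊆ Q .l := fun _ hz => Bm_left hz

lemma Q_unique {F : Set ℂ} (hF : IsBubble F) {i j : Pc} (hi : F ⊆ Q i) (hj : F ⊆ Q j) :
    i = j := by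
  obtain ⟨z, hz⟩ := bub_ne hF
  exact Q_disj (hi hz) (hj hz)

lemma al_Q {H : Set ℂ} (hH : IsBubble H) (h : H ≠ B0) {i : Pc} (hi : H ⊆ Q i)
    (hx : al ∈ closure H) : i = .l := by
  rcases al_cl hH hx with h1 | h1
  · exact absurd h1 h
  · subst h1; exact Q_unique Bm_bub hi Bm_Q

lemma neg_cl_Q {F G : Set ℂ} (hF : IsBubble F) (hG : IsBubble G) (h1 : F ≠ B0) (h2 : G ≠ B0)
    {i : Pc} (hFi : F ⊆ Q i) (hGi : G ⊆ Q i) {p : ℂ} (hp : p ∈ closure F)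
    (hp' : -p ∈ closure G) : False := by
  have ha := a_lo
  have key : ∀ H : Set ℂ, H ⊆ Q .l → -al ∈ closure H → False := by
    intro H hH hx
    have : (-al).re ≤ -a := cl_re_le (fun z hz => (hH hz : z.re < -a).le) hx
    rw [Complex.neg_re, al_re] at this
    linarith
  by_cases e1 : p = al
  · subst e1
    obtain rfl := al_Q hF h1 hFi hp
    exact key G hGi hp'
  by_cases e2 : p = -al
  · subst e2
    rw [neg_neg] at hp'
    obtain rfl := al_Q hG h2 hGi hp'
    exact key F hFi hp
  refine Q_neg (cl_Q hF h1 hFi hp e1 e2) (cl_Q hG h2 hGi hp' ?_ ?_)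
  · intro h; exact e2 (by rw [← h, neg_neg])
  · intro h; exact e1 (neg_injective h)

lemma f_inj_cl {F : Set ℂ} (hF : IsBubble F) (h : F ≠ B0) {p q : ℂ} (hp : p ∈ closure F)
    (hq : q ∈ closure F) (e : fBasilica p = fBasilica q) : p = q := by
  obtain ⟨i, hi⟩ := bub_Q hF h
  rcases f_eq e with e | e
  · exact e
  · exfalso; subst e
    exact neg_cl_Q hF hF h h hi hi hq hp

lemma disj_one {F G : Set ℂ} (hF : IsBubble F) (hG : IsBubble G) (h : fBasilica '' F = fBasilica '' G)
    {p : ℂ} (hp : p ∈ closure F) (hq : p ∈ closure G) : F = G := by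
  rcases merge hF hG h with e | e
  · exact e
  by_cases h0 : F = B0
  · have : G = B0 := by
      rw [h0] at e; rw [← neg_B0, e, neg_neg]
    rw [h0, this]
  · exfalso
    obtain ⟨i, hi⟩ := bub_Q hF h0
    have : -p ∈ closure F := by rw [e]; exact cl_neg hq
    exact neg_cl_Q hF hF h0 h0 hi hi hp this

lemma disj_it {F G : Set ℂ} (hF : IsBubble F) (hG : IsBubble G) (n : ℕ)
    (h : fBasilica^[n] '' F = fBasilica^[n] '' G)
    {p : ℂ} (hp : p ∈ closure F) (hq : p ∈ closure G) : F = G := by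
  induction n generalizing F G p with
  | zero => rwa [it_zero, it_zero] at h
  | succ n ih =>
    rw [it_succ, it_succ] at h
    refine disj_one hF hG (ih (bub_image hF) (bub_image hG) h (p := fBasilica p) ?_ ?_) hp hq
    · rw [cl_image hF]; exact ⟨p, hp, rfl⟩
    · rw [cl_image hG]; exact ⟨p, hq, rfl⟩

lemma it_inj_cl {F : Set ℂ} (hF : IsBubble F) (n : ℕ) (h : n ≤ bubbleGen F) {p q : ℂ}
    (hp : p ∈ closure F) (hq : q ∈ closure F) (e : fBasilica^[n] p = fBasilica^[n] q) : p = q := by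
  induction n generalizing F p q with
  | zero => exact e
  | succ n ih =>
    have hg := gen_image hF (by omega)
    refine f_inj_cl hF ((gen_pos hF).1 (by omega)) hp hq ?_
    refine ih (bub_image hF) (by omega) ?_ ?_ e
    · rw [cl_image hF]; exact ⟨p, hp, rfl⟩
    · rw [cl_image hF]; exact ⟨q, hq, rfl⟩

lemma B0_Bm_cl {x : ℂ} (h1 : x ∈ closure B0) (h2 : x ∈ closure Bm) : x = al := by
  refine line_al (bub_cl_X B0_bub h1) (le_antisymm ?_ ?_)
  · exact cl_re_le (fun z hz => (Bm_left hz).le) h2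
  · exact cl_le_re (fun z hz => (abs_lt.1 (B0_strip hz)).1.le) h1

/-- iterates of a bubble past its generation -/
lemma it_past {F : Set ℂ} (hF : IsBubble F) {n : ℕ} (h : bubbleGen F ≤ n) :
    (Even (n - bubbleGen F) ∧ fBasilica^[n] '' F = B0) ∨ (Odd (n - bubbleGen F) ∧ fBasilica^[n] '' F = Bm) := by
  have e : fBasilica^[n] '' F = fBasilica^[n - bubbleGen F] '' B0 := by
    rw [← gen_spec hF, ← it_add]; congr 2; omega
  rw [e]
  rcases Nat.even_or_odd' (n - bubbleGen F) with ⟨c, hc | hc⟩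
  · left; rw [hc, it_B0_even]; exact ⟨by simp, rfl⟩
  · right; rw [hc, it_B0_odd]; exact ⟨⟨c, rfl⟩, rfl⟩

lemma touch {F G : Set ℂ} (hF : IsBubble F) (hG : IsBubble G) (h : bubbleGen F < bubbleGen G)
    {x : ℂ} (h1 : x ∈ closure F) (h2 : x ∈ closure G) :
    Odd (bubbleGen G - bubbleGen F) ∧ fBasilica^[bubbleGen G] '' F = Bm ∧ fBasilica^[bubbleGen G] x = al := by
  rcases it_past hF h.le with ⟨_, h3⟩ | ⟨h3, h4⟩
  · exfalso
    have := disj_it hF hG _ (h3.trans (gen_spec hG).symm) h1 h2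
    rw [this] at h; omega
  · refine ⟨h3, h4, B0_Bm_cl ?_ ?_⟩
    · rw [← gen_spec hG]; exact it_cl _ h2
    · rw [← h4]; exact it_cl _ h1

lemma parent_unique {F F' G : Set ℂ} (hF : IsBubble F) (hF' : IsBubble F') (hG : IsBubble G)
    (h : bubbleGen F < bubbleGen G) (h' : bubbleGen F' < bubbleGen G)
    (ht : (closure F ∩ closure G).Nonempty) (ht' : (closure F' ∩ closure G).Nonempty) :
    F = F' := by
  obtain ⟨x, hx1, hx2⟩ := ht
  obtain ⟨y, hy1, hy2⟩ := ht'
  obtain ⟨_, a2, a3⟩ := touch hF hG h hx1 hx2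
  obtain ⟨_, b2, b3⟩ := touch hF' hG h' hy1 hy2
  have : x = y := it_inj_cl hG _ le_rfl hx2 hy2 (a3.trans b3.symm)
  subst this
  exact disj_it hF hF' _ (a2.trans b2.symm) hx1 hy1

lemma same_piece {F G : Set ℂ} (hF : IsBubble F) (hG : IsBubble G) (h1 : F ≠ B0) (h2 : G ≠ B0)
    (ht : (closure F ∩ closure G).Nonempty) {i : Pc} (hi : F ⊆ Q i) : G ⊆ Q i := by
  obtain ⟨x, hx1, hx2⟩ := ht
  obtain ⟨j, hj⟩ := bub_Q hG h2
  by_cases e1 : x = al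
  · subst e1
    rw [al_Q hF h1 hi hx1, ← al_Q hG h2 hj hx2]; exact hj
  by_cases e2 : x = -al
  · subst e2
    have key : ∀ H, IsBubble H → H ≠ B0 → -al ∈ closure H → H = -Bm := by
      intro H hH hne hx
      have := cl_neg hx
      rw [neg_neg] at this
      rcases al_cl (bub_neg hH) this with h | h
      · exact absurd (by rw [← neg_B0, ← h, neg_neg]) hne
      · rw [← h, neg_neg]
    rw [key G hG h2 hx2, ← key F hF h1 hx1]; exact hi
  rw [Q_disj (cl_Q hF h1 hi hx1 e1 e2) (cl_Q hG h2 hj hx2 e1 e2)]; exact hj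

/-! ### Rays -/

structure Ray (F : ℕ → Set ℂ) (x : ℂ) : Prop where
  bub : ∀ k, IsBubble (F k)
  tch : ∀ k, (closure (F k) ∩ closure (F (k + 1))).Nonempty
  gen : ∀ k, bubbleGen (F k) < bubbleGen (F (k + 1))
  land : RayLandsAt F x

lemma Ray.mono {F : ℕ → Set ℂ} {x : ℂ} (h : Ray F x) : StrictMono (fun k => bubbleGen (F k)) :=
  strictMono_nat_of_lt_succ h.gen

lemma Ray.shift {F : ℕ → Set ℂ} {x : ℂ} (h : Ray F x) (k : ℕ) : Ray (fun i => F (k + i)) x where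
  bub i := h.bub _
  tch i := h.tch _
  gen i := h.gen _
  land := by
    intro ε hε
    obtain ⟨K, hK⟩ := h.land ε hε
    exact ⟨K, fun i hi => hK _ (by omega)⟩

lemma Ray.gen0 {F : ℕ → Set ℂ} {x : ℂ} (h : Ray F x) (k : ℕ) :
    bubbleGen (F 0) ≤ bubbleGen (F k) := h.mono.monotone (Nat.zero_le k)

lemma Ray.push {F : ℕ → Set ℂ} {x : ℂ} (h : Ray F x) (h0 : 1 ≤ bubbleGen (F 0)) :
    Ray (fun i => fBasilica '' F i) (fBasilica x) where
  bub i := bub_image (h.bub i)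
  tch i := by
    obtain ⟨y, h1, h2⟩ := h.tch i
    refine ⟨fBasilica y, ?_, ?_⟩
    · rw [cl_image (h.bub _)]; exact ⟨y, h1, rfl⟩
    · rw [cl_image (h.bub _)]; exact ⟨y, h2, rfl⟩
  gen i := by
    have h1 := h.gen0 i
    have h2 := h.gen i
    rw [gen_image (h.bub i) (by omega), gen_image (h.bub (i + 1)) (by omega)]
    omega
  land := by
    intro ε hε
    obtain ⟨δ, hδ, hb⟩ := Metric.continuous_iff.1 f_cont x ε hε
    obtain ⟨K, hK⟩ := h.land δ hδ
    refine ⟨K, fun k hk => ?_⟩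
    rintro _ ⟨z, hz, rfl⟩
    exact hb z (hK k hk hz)

lemma Ray.pushn {F : ℕ → Set ℂ} {x : ℂ} (h : Ray F x) (n : ℕ) (h0 : n ≤ bubbleGen (F 0)) :
    Ray (fun i => fBasilica^[n] '' F i) (fBasilica^[n] x) ∧
      bubbleGen (fBasilica^[n] '' F 0) = bubbleGen (F 0) - n := by
  induction n generalizing F x with
  | zero => simpa using h
  | succ n ih =>
    have h1 := h.push (by omega)
    have h2 := gen_image (h.bub 0) (by omega)
    obtain ⟨h3, h4⟩ := ih h1 (by simp only [h2]; omega)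
    refine ⟨?_, ?_⟩
    · simpa only [it_succ, Function.iterate_succ_apply] using h3
    · rw [it_succ, h4, h2]; omega

lemma Ray.piece {F : ℕ → Set ℂ} {x : ℂ} (h : Ray F x) (h0 : 1 ≤ bubbleGen (F 0)) :
    ∃ i, ∀ k, F k ⊆ Q i := by
  have hne : ∀ k, F k ≠ B0 := fun k => (gen_pos (h.bub k)).1 (h0.trans (h.gen0 k))
  obtain ⟨i, hi⟩ := bub_Q (h.bub 0) (hne 0)
  refine ⟨i, fun k => ?_⟩
  induction k with
  | zero => exact hi
  | succ k ih => exact same_piece (h.bub k) (h.bub (k + 1)) (hne _) (hne _) (h.tch k) ih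

lemma Ray.al_aux (m : ℕ) : ∀ {F : ℕ → Set ℂ}, Ray F al → bubbleGen (F 0) = m + 1 →
    (F 0 ⊆ Q .l ∧ Odd (m + 1)) ∨ ((∀ z ∈ F 0, |z.re| < a) ∧ Even (m + 1)) := by
  have ha := a_lo
  induction m with
  | zero =>
    intro F h hm
    obtain ⟨i, hi⟩ := h.piece (by omega)
    have h1 := gen_spec (h.bub 0)
    rw [hm, it_succ, it_zero] at h1
    rcases pre_B0 (h.bub 0) h1 with h2 | h2
    · left; rw [h2]; exact ⟨Bm_Q, by decide⟩
    · exfalso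
      have hr : F 0 ⊆ Q .r := by
        intro z hz
        rw [h2] at hz
        have := Bm_left (z := -z) (by simpa using hz)
        rw [Complex.neg_re] at this
        change a < z.re
        linarith
      obtain rfl := Q_unique (h.bub 0) (hi 0) hr
      obtain ⟨K, hK⟩ := h.land a (by linarith)
      obtain ⟨z, hz⟩ := bub_ne (h.bub K)
      have h3 : a < z.re := hi K hz
      have h4 := hK K le_rfl hz
      rw [Metric.mem_ball, dist_eq_norm] at h4
      have h5 := (Complex.abs_re_le_norm (z - al)).trans h4.le
      rw [Complex.sub_re, al_re] at h5
      have := (abs_le.1 h5).2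
      linarith
  | succ m ih =>
    intro F h hm
    obtain ⟨i, hi⟩ := h.piece (by omega)
    have hp := h.push (by omega)
    rw [f_al] at hp
    have hg := gen_image (h.bub 0) (by omega)
    have hh := ih hp (by rw [hg, hm]; rfl)
    obtain ⟨z, hz⟩ := bub_ne (h.bub 0)
    have hzX : z ∈ X := subset_closure (bub_sub (h.bub 0) hz)
    have strip : (∀ z ∈ F 0, |z.re| < a) → Even (m + 1 + 1) := by
      intro hs
      rcases hh with ⟨_, h1⟩ | ⟨h1, _⟩
      · exact h1.add_one
      · exfalso
        have h2 := f_strip (hs z hz)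
        have h3 := (abs_lt.1 (h1 (fBasilica z) ⟨z, hz, rfl⟩)).1
        linarith
    cases i with
    | l =>
      left
      refine ⟨hi 0, ?_⟩
      rcases hh with ⟨h1, _⟩ | ⟨_, h1⟩
      · exfalso
        have h2 := f_out hzX (hi 0 hz)
        have h3 : (fBasilica z).re < -a := h1 ⟨z, hz, rfl⟩
        linarith
      · exact h1.add_one
    | r =>
      exfalso
      obtain ⟨K, hK⟩ := h.land a (by linarith)
      obtain ⟨z, hz⟩ := bub_ne (h.bub K)
      have h3 : a < z.re := hi K hz
      have h4 := hK K le_rfl hz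
      rw [Metric.mem_ball, dist_eq_norm] at h4
      have h5 := (Complex.abs_re_le_norm (z - al)).trans h4.le
      rw [Complex.sub_re, al_re] at h5
      have := (abs_le.1 h5).2
      linarith
    | u =>
      right
      have hs : ∀ z ∈ F 0, |z.re| < a := fun z hz => (hi 0 hz).1
      exact ⟨hs, strip hs⟩
    | d =>
      right
      have hs : ∀ z ∈ F 0, |z.re| < a := fun z hz => (hi 0 hz).1
      exact ⟨hs, strip hs⟩

lemma Ray.ne_al {F : ℕ → Set ℂ} {x : ℂ} (h : Ray F x) : x ≠ al := by
  rintro rfl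
  have ha := a_lo
  have h1 := h.shift 1
  have g1 : 1 ≤ bubbleGen (F 1) := by have := h.gen 0; simp only [zero_add] at this; omega
  have g2 := h.gen 1
  obtain ⟨i, hi⟩ := h1.piece (by simpa using g1)
  obtain ⟨m, hm⟩ : ∃ m, bubbleGen (F 1) = m + 1 := ⟨bubbleGen (F 1) - 1, by omega⟩
  obtain ⟨m', hm'⟩ : ∃ m, bubbleGen (F 2) = m + 1 := ⟨bubbleGen (F 2) - 1, by
    simp only [Nat.reduceAdd] at g2; omega⟩
  have e1 := Ray.al_aux m h1 (by simpa using hm)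
  have e2 := Ray.al_aux m' (h.shift 2) (by simpa using hm')
  obtain ⟨y, hy1, hy2⟩ := h.tch 1
  have ho := (touch (h.bub 1) (h.bub 2) g2 hy1 hy2).1
  rw [hm, hm'] at ho
  simp only [Nat.reduceAdd] at g2
  rw [hm, hm'] at g2
  have i1 : F 1 ⊆ Q i := by simpa using hi 0
  have i2 : F 2 ⊆ Q i := by simpa using hi 1
  simp only [add_zero] at e1 e2
  have bad : ∀ k, F k ⊆ Q .l → (∀ z ∈ F k, |z.re| < a) → False := by
    intro k h1 h2
    obtain ⟨z, hz⟩ := bub_ne (h.bub k)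
    have h3 : z.re < -a := h1 hz
    have := (abs_lt.1 (h2 z hz)).1
    linarith
  rw [Nat.odd_sub (by omega)] at ho
  rcases e1 with ⟨p1, q1⟩ | ⟨p1, q1⟩ <;> rcases e2 with ⟨p2, q2⟩ | ⟨p2, q2⟩
  · exact (Nat.not_even_iff_odd.2 q1) (ho.1 q2)
  · obtain rfl := Q_unique (h.bub 1) i1 p1
    exact bad 2 i2 p2
  · obtain rfl := Q_unique (h.bub 2) i2 p2
    exact bad 1 i1 p1
  · exact (Nat.not_odd_iff_even.2 q2) (ho.2 q1)

lemma Ray.iter_ne_al {F : ℕ → Set ℂ} {x : ℂ} (h : Ray F x) (n : ℕ) : fBasilica^[n] x ≠ al := by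
  have h1 : n ≤ bubbleGen (F n) := h.mono.id_le n
  exact ((h.shift n).pushn n (by simpa using h1)).1.ne_al

lemma Ray.ne_neg_al {F : ℕ → Set ℂ} {x : ℂ} (h : Ray F x) : x ≠ -al := by
  rintro rfl
  refine h.iter_ne_al 1 ?_
  simp only [Function.iterate_one]
  rw [f_neg, f_al]

lemma Ray.mem_X {F : ℕ → Set ℂ} {x : ℂ} (h : Ray F x) : x ∈ X := by
  refine Metric.mem_closure_iff.2 fun ε hε => ?_
  obtain ⟨K, hK⟩ := h.land ε hε
  obtain ⟨z, hz⟩ := bub_ne (h.bub K)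
  exact ⟨z, bub_sub (h.bub K) hz, by rw [dist_comm]; exact hK K le_rfl hz⟩

lemma Ray.not_B0 {F : ℕ → Set ℂ} {x : ℂ} (h : Ray F x) : x ∉ B0 := by
  intro hx
  obtain ⟨ε, hε, hb⟩ := Metric.isOpen_iff.1 (bub_open B0_bub) x hx
  obtain ⟨K, hK⟩ := h.land ε hε
  obtain ⟨z, hz⟩ := bub_ne (h.bub (K + 1))
  have h1 := bub_eq (h.bub _) B0_bub hz (hb (hK (K + 1) (by omega) hz))
  have h2 := h.gen K
  exact (gen_pos (h.bub (K + 1))).1 (by omega) h1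

lemma Ray.piece_x {F : ℕ → Set ℂ} {x : ℂ} (h : Ray F x) :
    ∃ i, x ∈ Q i := mem_Q h.mem_X h.not_B0 h.ne_al h.ne_neg_al

lemma Ray.sub_Q {F : ℕ → Set ℂ} {x : ℂ} (h : Ray F x) (h0 : 1 ≤ bubbleGen (F 0)) {i : Pc}
    (hi : x ∈ Q i) : F 0 ⊆ Q i := by
  obtain ⟨j, hj⟩ := h.piece h0
  obtain ⟨ε, hε, hb⟩ := Metric.isOpen_iff.1 (Q_open i) x hi
  obtain ⟨K, hK⟩ := h.land ε hε
  rw [← Q_unique (h.bub K) (hj K) ((hK K le_rfl).trans hb)]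
  exact hj 0

/-- Contacts can be pulled back along two rays landing at the same point. -/
lemma pull (n : ℕ) : ∀ {F G : ℕ → Set ℂ} {x : ℂ}, Ray F x → Ray G x →
    n ≤ bubbleGen (F 0) → n ≤ bubbleGen (G 0) →
    (closure (fBasilica^[n] '' F 0) ∩ closure (fBasilica^[n] '' G 0)).Nonempty →
    (closure (F 0) ∩ closure (G 0)).Nonempty := by
  induction n with
  | zero => intro F G x _ _ _ _ h; simpa using h
  | succ n ih =>
    intro F G x hF hG h1 h2 h
    have gF := gen_image (hF.bub 0) (by omega)
    have gG := gen_image (hG.bub 0) (by omega)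
    rw [it_succ, it_succ] at h
    obtain ⟨y, hy1, hy2⟩ := ih (hF.push (by omega)) (hG.push (by omega))
      (by simp only [gF]; omega) (by simp only [gG]; omega) h
    simp only [cl_image (hF.bub 0)] at hy1
    simp only [cl_image (hG.bub 0)] at hy2
    obtain ⟨p, hp, rfl⟩ := hy1
    obtain ⟨q, hq, e⟩ := hy2
    rcases f_eq e with e | e
    · subst e; exact ⟨q, hp, hq⟩
    · exfalso
      obtain ⟨i, hi⟩ := hF.piece_x
      subst e
      exact neg_cl_Q (hF.bub 0) (hG.bub 0) ((gen_pos (hF.bub 0)).1 (by omega))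
        ((gen_pos (hG.bub 0)).1 (by omega)) (hF.sub_Q (by omega) hi) (hG.sub_Q (by omega) hi) hp hq

lemma pull_eq {n : ℕ} {F G : ℕ → Set ℂ} {x : ℂ} (hF : Ray F x) (hG : Ray G x)
    (h1 : n ≤ bubbleGen (F 0)) (h2 : n ≤ bubbleGen (G 0))
    (h : fBasilica^[n] '' F 0 = fBasilica^[n] '' G 0) : F 0 = G 0 := by
  obtain ⟨p, hp, hq⟩ := pull n hF hG h1 h2 (by
    rw [h, Set.inter_self]; exact (bub_ne (bub_it (hG.bub 0) n)).closure)
  exact disj_it (hF.bub 0) (hG.bub 0) n h hp hq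

lemma common {F G : ℕ → Set ℂ} {x : ℂ} (hF : Ray F x) (hG : Ray G x) (k : ℕ)
    (h : bubbleGen (G 0) ≤ bubbleGen (F k)) : F k ∈ Set.range G ∨ F (k + 1) ∈ Set.range G := by
  set n := bubbleGen (F k) with hn
  obtain ⟨j, hj1, hj2⟩ : ∃ j, bubbleGen (G j) ≤ n ∧ n < bubbleGen (G (j + 1)) := by
    by_contra hc
    push Not at hc
    have : ∀ j, bubbleGen (G j) ≤ n := by
      intro j
      induction j with
      | zero => exact h
      | succ j ih => exact hc j ih
    have h1 : n + 1 ≤ bubbleGen (G (n + 1)) := hG.mono.id_le (n + 1)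
    have := this (n + 1)
    omega
  have rFk := hF.shift k
  have rFk1 := hF.shift (k + 1)
  have rG1 := hG.shift (j + 1)
  have gF := hF.gen k
  have tG : (closure (fBasilica^[n] '' G j) ∩ closure (fBasilica^[n] '' G (j + 1))).Nonempty := by
    obtain ⟨y, h1, h2⟩ := hG.tch j
    exact ⟨_, it_cl n h1, it_cl n h2⟩
  have tF : (closure (fBasilica^[n] '' F k) ∩ closure (fBasilica^[n] '' F (k + 1))).Nonempty := by
    obtain ⟨y, h1, h2⟩ := hF.tch k
    exact ⟨_, it_cl n h1, it_cl n h2⟩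
  have eF : fBasilica^[n] '' F k = B0 := gen_spec (hF.bub k)
  rcases it_past (hG.bub j) hj1 with ⟨_, hB⟩ | ⟨_, hB⟩
  · left
    refine ⟨j, ?_⟩
    have ht : (closure (F k) ∩ closure (G (j + 1))).Nonempty := by
      refine pull n rFk rG1 (by simpa using hn.le) (by simpa using hj2.le) ?_
      simpa [eF, hB] using tG
    exact parent_unique (hG.bub j) (hF.bub k) (hG.bub (j + 1)) (hG.gen j) hj2 (hG.tch j) ht
  · right
    have hGne : fBasilica^[n] '' G (j + 1) ≠ B0 := it_ne_B0 hj2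
    have hFne : fBasilica^[n] '' F (k + 1) ≠ B0 := it_ne_B0 gF
    have hGl : fBasilica^[n] '' G (j + 1) ⊆ Q .l := by
      refine same_piece Bm_bub (bub_it (hG.bub _) n) Bm_ne hGne ?_ Bm_Q
      rwa [hB] at tG
    obtain ⟨pG, gG⟩ := rG1.pushn n (by simpa using hj2.le)
    obtain ⟨pF, gF'⟩ := rFk1.pushn n (by simpa using gF.le)
    simp only [add_zero] at gG gF'
    obtain ⟨i, hi⟩ := pG.piece_x
    have s1 := pG.sub_Q (by simp only [add_zero]; rw [gG]; omega) hi
    have s2 := pF.sub_Q (by simp only [add_zero]; rw [gF']; omega) hi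
    simp only [add_zero] at s1 s2
    obtain rfl := Q_unique (bub_it (hG.bub (j + 1)) n) s1 hGl
    have eF1 : fBasilica^[n] '' F (k + 1) = Bm := by
      obtain ⟨y, hy1, hy2⟩ := tF
      rw [eF] at hy1
      have hy : y = al := by
        refine line_al (bub_cl_X B0_bub hy1) (le_antisymm ?_ ?_)
        · exact cl_re_le (fun z hz => (s2 hz : z.re < -a).le) hy2
        · exact cl_le_re (fun z hz => (abs_lt.1 (B0_strip hz)).1.le) hy1
      subst hy
      rcases al_cl (bub_it (hF.bub _) n) hy2 with h | h
      · exact absurd h hFne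
      · exact h
    have g1 : bubbleGen (F (k + 1)) = n + 1 := by
      have : bubbleGen (F (k + 1)) ≤ n + 1 := gen_le (by rw [it_succ', eF1, f_Bm])
      omega
    rcases Nat.lt_or_ge (n + 1) (bubbleGen (G (j + 1))) with hlt | hge
    · have ht : (closure (F (k + 1)) ∩ closure (G (j + 1))).Nonempty := by
        refine pull n rFk1 rG1 (by simpa using gF.le) (by simpa using hj2.le) ?_
        simpa [eF1, hB] using tG
      exact ⟨j, parent_unique (hG.bub j) (hF.bub (k + 1)) (hG.bub (j + 1)) (hG.gen j)
        (by omega) (hG.tch j) ht⟩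
    · have g2 : bubbleGen (G (j + 1)) = n + 1 := by omega
      refine ⟨j + 1, ?_⟩
      refine (pull_eq (n := n + 1) rFk1 rG1 (by simpa using g1.ge) (by simpa using g2.ge) ?_).symm
      have h1 := gen_spec (hF.bub (k + 1))
      have h2 := gen_spec (hG.bub (j + 1))
      rw [g1] at h1; rw [g2] at h2
      simpa using h1.trans h2.symm

lemma descend {F G : ℕ → Set ℂ} {x : ℂ} (hF : Ray F x) (hG : Ray G x) (i : ℕ) :
    ∀ {k j : ℕ}, F (k + i) = G (j + i) → F k = G j := by
  induction i with
  | zero => intro k j h; exact h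
  | succ i ih =>
    intro k j h
    apply ih
    have e : F (k + i + 1) = G (j + i + 1) := h
    refine parent_unique (hF.bub _) (hG.bub _) (hG.bub (j + i + 1)) ?_ (hG.gen _) ?_ (hG.tch _)
    · rw [← e]; exact hF.gen _
    · rw [← e]; exact hF.tch _

lemma main {F G : ℕ → Set ℂ} {x : ℂ} (hF : Ray F x) (hG : Ray G x) :
    Set.range F ⊆ Set.range G ∨ Set.range G ⊆ Set.range F := by
  have inf : ∀ K, ∃ k ≥ K, ∃ j, F k = G j := by
    intro K
    have h1 : K + bubbleGen (G 0) ≤ bubbleGen (F (K + bubbleGen (G 0))) := hF.mono.id_le _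
    rcases common hF hG (K + bubbleGen (G 0)) (by omega) with ⟨j, hj⟩ | ⟨j, hj⟩
    · exact ⟨_, by omega, j, hj.symm⟩
    · exact ⟨_, by omega, j, hj.symm⟩
  by_cases h0 : F 0 ∈ Set.range G
  · left
    obtain ⟨j0, hj0⟩ := h0
    rintro _ ⟨k, rfl⟩
    obtain ⟨k', hk', j', e⟩ := inf k
    by_cases hle : k' ≤ j'
    · refine ⟨j' - (k' - k), ?_⟩
      symm
      apply descend hF hG (k' - k)
      rw [show k + (k' - k) = k' by omega, show j' - (k' - k) + (k' - k) = j' by omega, e]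
    · exfalso
      have : F (k' - j') = G 0 := by
        apply descend hF hG j'
        rw [show k' - j' + j' = k' by omega, zero_add, e]
      have h1 := hG.gen0 j0
      have h2 : bubbleGen (F 0) < bubbleGen (F (k' - j')) := hF.mono (by omega)
      rw [this, ← hj0] at h2
      omega
  · right
    rintro _ ⟨j, rfl⟩
    obtain ⟨k', hk', j', e⟩ := inf (bubbleGen (G j))
    have h1 : k' ≤ bubbleGen (F k') := hF.mono.id_le _
    have hjj : j ≤ j' := by
      by_contra hc
      have : bubbleGen (G j') < bubbleGen (G j) := hG.mono (by omega)
      rw [← e] at this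
      omega
    have hlt : j' < k' := by
      by_contra hc
      refine h0 ⟨j' - k', ?_⟩
      symm
      apply descend hF hG k'
      rw [zero_add, show j' - k' + k' = j' by omega, e]
    refine ⟨k' - (j' - j), ?_⟩
    apply descend hF hG (j' - j)
    rw [show k' - (j' - j) + (j' - j) = k' by omega, show j + (j' - j) = j' by omega, e]

lemma ray_of {F : ℕ → Set ℂ} {x : ℂ} (h : IsBubbleRay F) (hx : RayLandsAt F x) : Ray F x where
  bub := h.1
  tch k := by
    obtain ⟨y, hy⟩ := h.2.1 k
    rw [hy]; exact Set.singleton_nonempty y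
  gen := h.2.2
  land := hx

end Basil

/-- If two infinite bubble rays of the basilica land at the same point, then one of them is
contained in the other. -/
theorem bubble_rays_same_landing_point (F G : ℕ → Set ℂ)
    (hF : IsBubbleRay F) (hG : IsBubbleRay G) (x : ℂ)
    (hFx : RayLandsAt F x) (hGx : RayLandsAt G x) :
    Set.range F ⊆ Set.range G ∨ Set.range G ⊆ Set.range F := by
  exact Basil.main (Basil.ray_of hF hFx) (Basil.ray_of hG hGx)
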